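/- Let 2 ≤ c < d be integers and S a nonempty subset of the vertices of the (c,d)-biregular tree rooted at o. Let a_t(S) be the number of vertices of S at distance t from o and b_t(S) the number of walks of length t from o ending in S; put α = limsup a_t(S)^{1/t}, β = limsup b_t(S)^{1/t}. Then β = √(c−1) + √(d−1) if α ≤ ((c−1)(d−1))^{1/4}, and β = √(α² + c + d − 2 + (c−1)(d−1)/α²) if α ≥ ((c−1)(d−1))^{1/4}. -/

import Mathlib

open Filter Topology

section Limsup

variable {u : ℕ → ℝ} {C y : ℝ}

lemma tendsto_const_rpow_one_div (hC : 0 < C) (y : ℝ) :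
    Tendsto (fun n : ℕ => C ^ ((1 : ℝ) / n) * y) atTop (𝓝 y) := by
  have h : Tendsto (fun n : ℕ => C ^ ((1 : ℝ) / n)) atTop (𝓝 (C ^ (0 : ℝ))) :=
    (Real.continuousAt_const_rpow hC.ne').tendsto.comp tendsto_one_div_atTop_nhds_zero_nat
  simpa using h.mul_const y

lemma eventually_rpow_le_of_le_mul_pow (hu : ∀ n, 0 ≤ u n) (hC : 0 < C) (hy : 0 < y)
    (h : ∀ n, u n ≤ C * y ^ n) :
    (fun n : ℕ => u n ^ ((1 : ℝ) / n)) ≤ᶠ[atTop] fun n : ℕ => C ^ ((1 : ℝ) / n) * y := by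
  filter_upwards [eventually_ge_atTop 1] with n hn
  calc u n ^ ((1 : ℝ) / n) ≤ (C * y ^ n) ^ ((1 : ℝ) / n) :=
        Real.rpow_le_rpow (hu n) (h n) (by positivity)
    _ = C ^ ((1 : ℝ) / n) * y := by
        rw [Real.mul_rpow hC.le (by positivity), one_div, Real.pow_rpow_inv_natCast hy.le (by omega)]

lemma isBoundedUnder_rpow_of_le_mul_pow (hu : ∀ n, 0 ≤ u n) (hC : 0 < C) (hy : 0 < y)
    (h : ∀ n, u n ≤ C * y ^ n) :
    IsBoundedUnder (· ≤ ·) atTop fun n : ℕ => u n ^ ((1 : ℝ) / n) :=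
  (tendsto_const_rpow_one_div hC y).isBoundedUnder_le.mono_le
    (eventually_rpow_le_of_le_mul_pow hu hC hy h)

lemma limsup_rpow_le_of_le_mul_pow (hu : ∀ n, 0 ≤ u n) (hC : 0 < C) (hy : 0 < y)
    (h : ∀ n, u n ≤ C * y ^ n) :
    limsup (fun n : ℕ => u n ^ ((1 : ℝ) / n)) atTop ≤ y := by
  rw [← (tendsto_const_rpow_one_div hC y).limsup_eq]
  exact limsup_le_limsup (eventually_rpow_le_of_le_mul_pow hu hC hy h)
    (isCoboundedUnder_le_of_le _ fun n => Real.rpow_nonneg (hu n) _)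
    (tendsto_const_rpow_one_div hC y).isBoundedUnder_le

lemma limsup_rpow_nonneg (hu : ∀ n, 0 ≤ u n)
    (hb : IsBoundedUnder (· ≤ ·) atTop fun n : ℕ => u n ^ ((1 : ℝ) / n)) :
    0 ≤ limsup (fun n : ℕ => u n ^ ((1 : ℝ) / n)) atTop :=
  le_limsup_of_frequently_le (Frequently.of_forall fun n => Real.rpow_nonneg (hu n) _) hb

lemma exists_le_mul_pow_of_limsup_rpow_lt (hu : ∀ n, 0 ≤ u n)
    (hb : IsBoundedUnder (· ≤ ·) atTop fun n : ℕ => u n ^ ((1 : ℝ) / n))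
    (h : limsup (fun n : ℕ => u n ^ ((1 : ℝ) / n)) atTop < y) :
    ∃ C > 0, ∀ n, u n ≤ C * y ^ n := by
  have hy : 0 < y := (limsup_rpow_nonneg hu hb).trans_lt h
  obtain ⟨N, hN⟩ := eventually_atTop.1 (eventually_lt_of_limsup_lt h hb)
  have hs : ∀ n, 0 ≤ u n / y ^ n := fun n => div_nonneg (hu n) (by positivity)
  refine ⟨1 + ∑ n ∈ Finset.range (N + 1), u n / y ^ n,
    by linarith [Finset.sum_nonneg fun n (_ : n ∈ Finset.range (N + 1)) => hs n], fun n => ?_⟩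
  rcases lt_or_ge n (N + 1) with hn | hn
  · rw [← div_le_iff₀ (by positivity)]
    linarith [Finset.single_le_sum (fun n _ => hs n) (Finset.mem_range.2 hn)]
  · have h1 : u n ≤ y ^ n := by
      have := pow_le_pow_left₀ (Real.rpow_nonneg (hu n) _) (hN n (by omega)).le n
      rwa [one_div, Real.rpow_inv_natCast_pow (hu n) (by omega)] at this
    have h2 : 0 ≤ ∑ n ∈ Finset.range (N + 1), u n / y ^ n := Finset.sum_nonneg fun n _ => hs n
    nlinarith [pow_pos hy n]

end Limsup

section Recurrence

variable {u : ℕ → ℝ} {p D : ℝ}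

lemma not_forall_pos_of_add_one_le_sub {r : ℕ → ℝ} {δ : ℝ} (hδ : 0 < δ)
    (h : ∀ k, r (k + 1) ≤ r k - δ) : ¬ ∀ k, 0 < r k := by
  intro hr
  have h' : ∀ k : ℕ, r k ≤ r 0 - k * δ := by
    intro k
    induction k with
    | zero => simp
    | succ k ih => push_cast; linarith [h k]
  obtain ⟨k, hk⟩ := exists_nat_gt (r 0 / δ)
  rw [div_lt_iff₀ hδ] at hk
  linarith [h' k, hr k]

lemma ratio_recurrence (hp : 0 < p) (hu : ∀ k, 0 < u k)
    (h : ∀ k, p * u (k + 2) = D * u (k + 1) - u k) (k : ℕ) :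
    u (k + 2) / u (k + 1) = (D - 1 / (u (k + 1) / u k)) / p := by
  have := hu k
  have := hu (k + 1)
  field_simp
  linarith [h k]

lemma two_mul_sqrt_le_of_pos_recurrence (hp : 0 < p) (hu : ∀ k, 0 < u k)
    (h : ∀ k, p * u (k + 2) = D * u (k + 1) - u k) : 2 * √p ≤ D := by
  by_contra! hD
  refine not_forall_pos_of_add_one_le_sub (r := fun k => u (k + 1) / u k)
    (δ := (2 * √p - D) / p) (div_pos (by linarith) hp) (fun k => ?_)
    (fun k => div_pos (hu _) (hu _))
  have hr : 0 < u (k + 1) / u k := div_pos (hu _) (hu _)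
  simp only [ratio_recurrence hp hu h k]
  set r := u (k + 1) / u k
  have : 2 * √p ≤ 1 / r + p * r := by
    rw [div_add' _ _ _ hr.ne', le_div_iff₀ hr]
    have : (√p * r - 1) ^ 2 = p * r ^ 2 - 2 * √p * r + 1 := by
      rw [sub_sq, mul_pow, Real.sq_sqrt hp.le]
      ring
    nlinarith [sq_nonneg (√p * r - 1)]
  rw [show r - (2 * √p - D) / p = (p * r - (2 * √p - D)) / p by field_simp]
  exact div_le_div_of_nonneg_right (by linarith) hp.le

lemma mul_le_of_pos_recurrence {s : ℝ} (hp : 0 < p) (hs : 0 < s) (hps : p * s ^ 2 ≤ 1)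
    (hD : D ≤ 1 / s + p * s) (hu : ∀ k, 0 < u k)
    (h : ∀ k, p * u (k + 2) = D * u (k + 1) - u k) : s * u 0 ≤ u 1 := by
  by_contra! hlt
  have hr : ∀ k, 0 < u (k + 1) / u k := fun k => div_pos (hu _) (hu _)
  have hfun : ∀ x y : ℝ, 0 < x → x ≤ y → y ≤ s → 1 / y + p * y ≤ 1 / x + p * x := by
    intro x y hx hxy hys
    have hy : 0 < y := hx.trans_le hxy
    have hpxy : p * (x * y) ≤ 1 := by
      refine le_trans ?_ hps
      rw [sq]
      gcongr
      linarith
    have : 1 / x + p * x - (1 / y + p * y) = (y - x) * (1 - p * (x * y)) / (x * y) := by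
      field_simp
      ring
    have : 0 ≤ (y - x) * (1 - p * (x * y)) / (x * y) :=
      div_nonneg (mul_nonneg (by linarith) (by linarith)) (by positivity)
    linarith
  set r₀ := u 1 / u 0 with hr₀
  have hr₀s : r₀ < s := by rwa [hr₀, div_lt_iff₀ (hu 0)]
  have hr₀pos : 0 < r₀ := hr 0
  set δ := (1 / r₀ + p * r₀ - D) / p with hδ
  have hδpos : 0 < δ := by
    refine div_pos ?_ hp
    have h1 : p * (s * r₀) < 1 := by
      refine lt_of_lt_of_le ?_ hps
      rw [sq]
      gcongr
    have : 1 / r₀ + p * r₀ - (1 / s + p * s) = (s - r₀) * (1 - p * (s * r₀)) / (s * r₀) := by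
      field_simp
      ring
    have : 0 < (s - r₀) * (1 - p * (s * r₀)) / (s * r₀) :=
      div_pos (mul_pos (by linarith) (by linarith)) (by positivity)
    linarith
  have hstep : ∀ k, u (k + 1) / u k ≤ r₀ → u (k + 2) / u (k + 1) ≤ u (k + 1) / u k - δ := by
    intro k hk
    rw [ratio_recurrence hp hu h k]
    have := hfun _ _ (hr k) hk hr₀s.le
    set r := u (k + 1) / u k
    rw [show r - δ = (p * r - (1 / r₀ + p * r₀ - D)) / p by rw [hδ]; field_simp]
    exact div_le_div_of_nonneg_right (by linarith) hp.le
  have hle : ∀ k, u (k + 1) / u k ≤ r₀ := by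
    intro k
    induction k with
    | zero => exact le_rfl
    | succ k ih => linarith [hstep k ih]
  exact not_forall_pos_of_add_one_le_sub (r := fun k => u (k + 1) / u k) hδpos
    (fun k => hstep k (hle k)) hr

end Recurrence

section Radial

/-- `radialWalkCount q t n` is the number of walks of length `t` from a vertex at distance `n` from
the root to the root, in a tree whose vertices at distance `n` from the root have `q n + 1`
neighbours. -/
def radialWalkCount (q : ℕ → ℝ) : ℕ → ℕ → ℝ
  | 0, n => if n = 0 then 1 else 0
  | t + 1, 0 => (q 0 + 1) * radialWalkCount q t 1
  | t + 1, n + 1 => radialWalkCount q t n + q (n + 1) * radialWalkCount q t (n + 2)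

/-- The exponential growth rate attached to a distance growth rate `y`, where `σ` and `π` are the
sum and the product of the two branching numbers. -/
noncomputable def walkGrowth (σ π y : ℝ) : ℝ := √(y ^ 2 + σ + π / y ^ 2)

/-- A radial function on the tree, multiplied by at most `l` when summed over neighbours. -/
noncomputable def radialWeight (q : ℕ → ℝ) (l y : ℝ) : ℕ → ℝ
  | 0 => 1
  | n + 1 => (1 + q (n + 1) / y ^ 2) / l * radialWeight q l y n

variable {q : ℕ → ℝ} {l y z : ℝ}

lemma sum_period_two (hper : ∀ n, q (n + 2) = q n) (n : ℕ) : q n + q (n + 1) = q 0 + q 1 := by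
  induction n with
  | zero => rfl
  | succ n ih => rw [hper n]; linarith

lemma prod_period_two (hper : ∀ n, q (n + 2) = q n) (n : ℕ) : q n * q (n + 1) = q 0 * q 1 := by
  induction n with
  | zero => rfl
  | succ n ih => rw [hper n, ← ih]; ring

lemma radialWalkCount_nonneg (hq : ∀ n, 1 ≤ q n) (t n : ℕ) : 0 ≤ radialWalkCount q t n := by
  induction t generalizing n with
  | zero => rw [radialWalkCount]; split_ifs <;> norm_num
  | succ t ih =>
    cases n with
    | zero => exact mul_nonneg (by linarith [hq 0]) (ih 1)
    | succ n => exact add_nonneg (ih n) (mul_nonneg (by linarith [hq (n + 1)]) (ih (n + 2)))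

lemma radialWalkCount_le_succ_succ (hq : ∀ n, 1 ≤ q n) (t n : ℕ) :
    radialWalkCount q t n ≤ radialWalkCount q (t + 1) (n + 1) := by
  rw [radialWalkCount]
  have := mul_nonneg (by linarith [hq (n + 1)] : 0 ≤ q (n + 1))
    (radialWalkCount_nonneg hq t (n + 2))
  linarith

lemma radialWalkCount_succ_le_succ (hq : ∀ n, 1 ≤ q n) (t n : ℕ) :
    radialWalkCount q t (n + 1) ≤ radialWalkCount q (t + 1) n := by
  have h := radialWalkCount_nonneg hq t
  cases n with
  | zero =>
    rw [radialWalkCount]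
    nlinarith [hq 0, h 1]
  | succ n =>
    rw [radialWalkCount]
    nlinarith [hq (n + 1), h n, h (n + 2)]

lemma one_le_radialWalkCount_self (hq : ∀ n, 1 ≤ q n) (n : ℕ) : 1 ≤ radialWalkCount q n n := by
  induction n with
  | zero => simp [radialWalkCount]
  | succ n ih => exact ih.trans (radialWalkCount_le_succ_succ hq n n)

lemma radialWalkCount_eq_zero_of_lt {t n : ℕ} (h : t < n) : radialWalkCount q t n = 0 := by
  induction t generalizing n with
  | zero => simp [radialWalkCount, h.ne']
  | succ t ih =>
    cases n with
    | zero => omega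
    | succ n => rw [radialWalkCount, ih (by omega), ih (by omega)]; simp

lemma walkGrowth_pos {σ π : ℝ} (hσ : 0 < σ) (hπ : 0 ≤ π) (y : ℝ) : 0 < walkGrowth σ π y :=
  Real.sqrt_pos.2 (by positivity)

lemma walkGrowth_sq {σ π : ℝ} (hσ : 0 < σ) (hπ : 0 ≤ π) (y : ℝ) :
    walkGrowth σ π y ^ 2 = y ^ 2 + σ + π / y ^ 2 :=
  Real.sq_sqrt (by positivity)

lemma continuousAt_walkGrowth (σ π : ℝ) (hy : y ≠ 0) : ContinuousAt (walkGrowth σ π) y := by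
  unfold walkGrowth
  fun_prop (disch := positivity)

section Weight

variable (hq : ∀ n, 1 ≤ q n) (hper : ∀ n, q (n + 2) = q n) (hl : 0 < l) (hy : 1 ≤ y)
  (hly : l ^ 2 = y ^ 2 + (q 0 + q 1) + q 0 * q 1 / y ^ 2)

include hq hl hy in
lemma radialWeight_pos (n : ℕ) : 0 < radialWeight q l y n := by
  induction n with
  | zero => exact one_pos
  | succ n ih =>
    have := hq (n + 1)
    rw [radialWeight]
    positivity

include hper hl hy hly in
lemma radialWeight_add_two (n : ℕ) :
    radialWeight q l y (n + 2) = radialWeight q l y n / y ^ 2 := by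
  rw [radialWeight, radialWeight]
  have h : (1 + q (n + 1 + 1) / y ^ 2) * (1 + q (n + 1) / y ^ 2) * y ^ 2 = l ^ 2 := by
    rw [hly, ← sum_period_two hper (n + 1), ← prod_period_two hper (n + 1)]
    field_simp
    ring
  have h' : (1 + q (n + 1 + 1) / y ^ 2) * (1 + q (n + 1) / y ^ 2) = l ^ 2 / y ^ 2 := by
    rw [← h]; field_simp
  rw [← mul_assoc, div_mul_div_comm, h']
  field_simp

include hq hper hl hy hly in
lemma radialWalkCount_le_radialWeight (t n : ℕ) :
    radialWalkCount q t n ≤ l ^ t * radialWeight q l y n := by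
  have hpos := radialWeight_pos hq hl hy
  induction t generalizing n with
  | zero =>
    rw [radialWalkCount]
    split_ifs with h
    · simp [h, radialWeight]
    · simpa using (hpos n).le
  | succ t ih =>
    cases n with
    | zero =>
      rw [radialWalkCount]
      have h0 := hq 0
      have h1 := hq 1
      have hkey : (q 0 + 1) * (1 + q 1 / y ^ 2) ≤ l ^ 2 := by
        rw [hly, show q 0 * q 1 / y ^ 2 = q 0 * (q 1 / y ^ 2) by ring]
        have h2 : q 1 / y ^ 2 ≤ q 1 := div_le_self (by linarith) (one_le_pow₀ hy)
        linarith [one_le_pow₀ (n := 2) hy]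
      calc (q 0 + 1) * radialWalkCount q t 1
          ≤ (q 0 + 1) * (l ^ t * radialWeight q l y 1) := by gcongr; exact ih 1
        _ = l ^ t * ((q 0 + 1) * (1 + q 1 / y ^ 2) / l) := by
          simp only [radialWeight]; ring_nf
        _ ≤ l ^ t * (l ^ 2 / l) := by gcongr
        _ = l ^ (t + 1) * radialWeight q l y 0 := by
          simp only [radialWeight]; field_simp; ring
    | succ n =>
      have h1 := hq (n + 1)
      calc radialWalkCount q (t + 1) (n + 1)
          = radialWalkCount q t n + q (n + 1) * radialWalkCount q t (n + 2) := rfl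
        _ ≤ l ^ t * radialWeight q l y n +
              q (n + 1) * (l ^ t * radialWeight q l y (n + 2)) := by
          gcongr
          · exact ih n
          · exact ih (n + 2)
        _ = l ^ (t + 1) * radialWeight q l y (n + 1) := by
          rw [radialWeight_add_two hper hl hy hly, radialWeight]
          field_simp
          ring

include hq hper hl hy hly in
lemma exists_radialWeight_le : ∃ C > 0, ∀ n, radialWeight q l y n * y ^ n ≤ C := by
  have hpos := radialWeight_pos hq hl hy
  have h1 : 0 < radialWeight q l y 1 * y := mul_pos (hpos 1) (by linarith)
  refine ⟨1 + radialWeight q l y 1 * y, by linarith, fun n => ?_⟩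
  induction n using Nat.twoStepInduction with
  | zero => simpa [radialWeight] using h1.le
  | one => simp
  | more n ih _ =>
    rw [radialWeight_add_two hper hl hy hly]
    convert ih using 1
    field_simp
    ring

end Weight

section GeneratingFunction

variable (hq : ∀ n, 1 ≤ q n) (hz : 0 < z)

include hq hz in
lemma summable_radialWalkCount_all {m : ℕ} (h : Summable fun t => radialWalkCount q t m * z ^ t)
    (n : ℕ) : Summable fun t => radialWalkCount q t n * z ^ t := by
  have hnn : ∀ k t, 0 ≤ radialWalkCount q t k * z ^ t := fun k t =>
    mul_nonneg (radialWalkCount_nonneg hq t k) (by positivity)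
  have aux : ∀ i j, (∀ t, radialWalkCount q t i ≤ radialWalkCount q (t + 1) j) →
      (Summable fun t => radialWalkCount q t j * z ^ t) →
      Summable fun t => radialWalkCount q t i * z ^ t := by
    intro i j hij hj
    refine Summable.of_nonneg_of_le (hnn i) (fun t => ?_)
      (((summable_nat_add_iff 1).2 hj).div_const z)
    rw [pow_succ, ← mul_assoc, mul_div_assoc, div_self hz.ne', mul_one]
    gcongr
    exact hij t
  have hdown : ∀ k, (Summable fun t => radialWalkCount q t (k + 1) * z ^ t) →
      Summable fun t => radialWalkCount q t k * z ^ t :=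
    fun k => aux _ _ fun t => radialWalkCount_le_succ_succ hq t k
  have h0 : Summable fun t => radialWalkCount q t 0 * z ^ t := by
    induction m with
    | zero => exact h
    | succ m ih => exact ih (hdown m h)
  induction n with
  | zero => exact h0
  | succ n ih => exact aux _ _ (fun t => radialWalkCount_succ_le_succ hq t n) ih

include hq hz in
lemma tsum_radialWalkCount_pos (h : ∀ n, Summable fun t => radialWalkCount q t n * z ^ t) (n : ℕ) :
    0 < ∑' t, radialWalkCount q t n * z ^ t :=
  (h n).tsum_pos (fun t => mul_nonneg (radialWalkCount_nonneg hq t n) (by positivity)) n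
    (mul_pos (by linarith [one_le_radialWalkCount_self hq n]) (by positivity))

lemma tsum_radialWalkCount_succ (h : ∀ n, Summable fun t => radialWalkCount q t n * z ^ t) (n : ℕ) :
    ∑' t, radialWalkCount q t (n + 1) * z ^ t =
      z * (∑' t, radialWalkCount q t n * z ^ t +
        q (n + 1) * ∑' t, radialWalkCount q t (n + 2) * z ^ t) := by
  rw [(h (n + 1)).tsum_eq_zero_add, ← tsum_mul_left, ← (h n).tsum_add ((h (n + 2)).mul_left _),
    ← tsum_mul_left]
  simp only [radialWalkCount, Nat.succ_ne_zero, if_false, zero_mul, zero_add]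
  congr 1
  ext t
  ring

include hz in
lemma tsum_radialWalkCount_add_four (hper : ∀ n, q (n + 2) = q n)
    (h : ∀ n, Summable fun t => radialWalkCount q t n * z ^ t) (n : ℕ) :
    q 0 * q 1 * ∑' t, radialWalkCount q t (n + 4) * z ^ t =
      (1 / z ^ 2 - (q 0 + q 1)) * ∑' t, radialWalkCount q t (n + 2) * z ^ t -
        ∑' t, radialWalkCount q t n * z ^ t := by
  have h1 := tsum_radialWalkCount_succ h n
  have h2 := tsum_radialWalkCount_succ h (n + 1)
  have h3 := tsum_radialWalkCount_succ h (n + 2)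
  rw [← sum_period_two hper (n + 1), ← prod_period_two hper (n + 1)]
  simp only [add_assoc, Nat.reduceAdd] at *
  rw [hper (n + 1)] at h3
  generalize ∑' t, radialWalkCount q t n * z ^ t = g0 at *
  generalize ∑' t, radialWalkCount q t (n + 1) * z ^ t = g1 at *
  generalize ∑' t, radialWalkCount q t (n + 2) * z ^ t = g2 at *
  generalize ∑' t, radialWalkCount q t (n + 3) * z ^ t = g3 at *
  generalize ∑' t, radialWalkCount q t (n + 4) * z ^ t = g4 at *
  rw [h1, h3] at h2
  field_simp
  linarith

end GeneratingFunction

end Radial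

section Growth

lemma walkGrowth_rpow_one_div_four {p r : ℝ} (hp : 0 < p) (hr : 0 < r) :
    walkGrowth (p + r) (p * r) ((p * r) ^ ((1 : ℝ) / 4)) = √p + √r := by
  have h : ((p * r) ^ ((1 : ℝ) / 4)) ^ 2 = √p * √r := by
    rw [← Real.sqrt_mul hp.le, Real.sqrt_eq_rpow, ← Real.rpow_natCast,
      ← Real.rpow_mul (by positivity)]
    norm_num
  rw [walkGrowth, h, ← Real.sqrt_sq (by positivity : 0 ≤ √p + √r)]
  congr 1
  have hp' := Real.sq_sqrt hp.le
  have hr' := Real.sq_sqrt hr.le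
  have : 0 < √p := by positivity
  have : 0 < √r := by positivity
  generalize √p = s at *
  generalize √r = t at *
  subst hp' hr'
  field_simp
  ring

variable {q a b : ℕ → ℝ} (hq : ∀ n, 1 ≤ q n) (hper : ∀ n, q (n + 2) = q n)
  (ha : ∀ n, 0 ≤ a n) (hab : ∀ t, b t = ∑ n ∈ Finset.range (t + 1), a n * radialWalkCount q t n)

include hq ha hab in
lemma mul_radialWalkCount_le (t n : ℕ) : a n * radialWalkCount q t n ≤ b t := by
  rcases lt_or_ge t n with h | h
  · rw [radialWalkCount_eq_zero_of_lt h, mul_zero, hab]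
    exact Finset.sum_nonneg fun k _ => mul_nonneg (ha k) (radialWalkCount_nonneg hq t k)
  · rw [hab]
    exact Finset.single_le_sum (f := fun n => a n * radialWalkCount q t n)
      (fun k _ => mul_nonneg (ha k) (radialWalkCount_nonneg hq t k)) (Finset.mem_range.2 (by omega))

include hq ha hab in
lemma walkSeries_nonneg (t : ℕ) : 0 ≤ b t := by
  rw [hab]
  exact Finset.sum_nonneg fun k _ => mul_nonneg (ha k) (radialWalkCount_nonneg hq t k)

include hq hper hab in
/-- Upper bound: if `a` grows strictly slower than `y ^ n`, then `b` grows at most like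
`walkGrowth _ _ y ^ t`. -/
lemma exists_le_mul_walkGrowth_pow {y w C : ℝ} (hy : 1 ≤ y) (hw : 0 < w) (hwy : w < y)
    (hC : 0 < C) (haC : ∀ n, a n ≤ C * w ^ n) :
    ∃ K > 0, ∀ t, b t ≤ K * walkGrowth (q 0 + q 1) (q 0 * q 1) y ^ t := by
  have h0 := hq 0
  have h1 := hq 1
  set l := walkGrowth (q 0 + q 1) (q 0 * q 1) y with hldef
  have hl : 0 < l := walkGrowth_pos (by linarith) (by positivity) y
  have hly := walkGrowth_sq (by linarith : 0 < q 0 + q 1) (by positivity : 0 ≤ q 0 * q 1) y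
  rw [← hldef] at hly
  have hy0 : 0 < y := by linarith
  obtain ⟨H, hH, hHle⟩ := exists_radialWeight_le hq hper hl hy hly
  have hr : w / y < 1 := (div_lt_one hy0).2 hwy
  have hr0 : 0 ≤ w / y := by positivity
  refine ⟨C * H * (1 - w / y)⁻¹, mul_pos (mul_pos hC hH) (inv_pos.2 (by linarith)), fun t => ?_⟩
  have hterm : ∀ n, a n * radialWalkCount q t n ≤ C * H * l ^ t * (w / y) ^ n := by
    intro n
    calc a n * radialWalkCount q t n
        ≤ (C * w ^ n) * (l ^ t * (H / y ^ n)) := by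
          refine mul_le_mul (haC n) ?_ (radialWalkCount_nonneg hq t n) (by positivity)
          refine (radialWalkCount_le_radialWeight hq hper hl hy hly t n).trans ?_
          gcongr
          rw [le_div_iff₀ (by positivity)]
          exact hHle n
      _ = C * H * l ^ t * (w / y) ^ n := by rw [div_pow]; ring
  calc b t ≤ ∑ n ∈ Finset.range (t + 1), C * H * l ^ t * (w / y) ^ n := by
        rw [hab]; exact Finset.sum_le_sum fun n _ => hterm n
    _ = C * H * l ^ t * ∑ n ∈ Finset.range (t + 1), (w / y) ^ n := by rw [Finset.mul_sum]
    _ ≤ C * H * l ^ t * (1 - w / y)⁻¹ := by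
        gcongr
        rw [← tsum_geometric_of_lt_one hr0 hr]
        exact (summable_geometric_of_lt_one hr0 hr).sum_le_tsum _ fun n _ => by positivity
    _ = C * H * (1 - w / y)⁻¹ * l ^ t := by ring

section LowerBound

variable (hne : ∃ n, 1 ≤ a n) {z : ℝ} (hz : 0 < z) (hb : Summable fun t => b t * z ^ t)

include hq ha hab hne hz hb in
lemma summable_radialWalkCount_of_summable (n : ℕ) :
    Summable fun t => radialWalkCount q t n * z ^ t := by
  obtain ⟨m, hm⟩ := hne
  refine summable_radialWalkCount_all hq hz (m := m) (Summable.of_nonneg_of_le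
    (fun t => mul_nonneg (radialWalkCount_nonneg hq t m) (by positivity)) (fun t => ?_) hb) n
  gcongr
  exact (le_mul_of_one_le_left (radialWalkCount_nonneg hq t m) hm).trans
    (mul_radialWalkCount_le hq ha hab t m)

include hq hper ha hab hne hz hb in
lemma sqrt_add_sqrt_le_inv : √(q 0) + √(q 1) ≤ z⁻¹ := by
  have h0 := hq 0
  have h1 := hq 1
  have hs := summable_radialWalkCount_of_summable hq ha hab hne hz hb
  have h := two_mul_sqrt_le_of_pos_recurrence (p := q 0 * q 1) (D := 1 / z ^ 2 - (q 0 + q 1))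
    (u := fun k => ∑' t, radialWalkCount q t (2 * k) * z ^ t) (by positivity)
    (fun k => tsum_radialWalkCount_pos hq hz hs (2 * k))
    (fun k => tsum_radialWalkCount_add_four hz hper hs (2 * k))
  refine le_of_sq_le_sq ?_ (by positivity)
  rw [add_sq, Real.sq_sqrt (by linarith), Real.sq_sqrt (by linarith), inv_pow, ← one_div]
  rw [Real.sqrt_mul (by linarith)] at h
  linarith

include hq hper ha hab hne hz hb in
lemma exists_le_mul_pow_of_summable {y : ℝ} (hy : 0 < y) (hpy : q 0 * q 1 ≤ y ^ 4)
    (hzy : z⁻¹ ^ 2 ≤ walkGrowth (q 0 + q 1) (q 0 * q 1) y ^ 2) :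
    ∃ C > 0, ∀ n, a n ≤ C * y ^ n := by
  have h0 := hq 0
  have h1 := hq 1
  have hs := summable_radialWalkCount_of_summable hq ha hab hne hz hb
  have hpos := tsum_radialWalkCount_pos hq hz hs
  rw [walkGrowth_sq (by linarith) (by positivity)] at hzy
  have hrat : ∀ n, 1 / y ^ 2 * ∑' t, radialWalkCount q t n * z ^ t ≤
      ∑' t, radialWalkCount q t (n + 2) * z ^ t := by
    intro n
    refine mul_le_of_pos_recurrence (p := q 0 * q 1) (D := 1 / z ^ 2 - (q 0 + q 1))
      (u := fun k => ∑' t, radialWalkCount q t (n + 2 * k) * z ^ t) (by positivity)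
      (by positivity) ?_ ?_ (fun k => hpos _)
      (fun k => tsum_radialWalkCount_add_four hz hper hs (n + 2 * k))
    · rw [one_div, inv_pow, ← pow_mul, ← div_eq_mul_inv]
      exact (div_le_one (by positivity)).2 hpy
    · rw [inv_pow] at hzy
      rw [one_div_one_div, mul_one_div, one_div]
      linarith
  have hge : ∃ c > 0, ∀ n, c ≤ y ^ n * ∑' t, radialWalkCount q t n * z ^ t := by
    refine ⟨min (∑' t, radialWalkCount q t 0 * z ^ t) (y * ∑' t, radialWalkCount q t 1 * z ^ t),
      lt_min (hpos 0) (mul_pos hy (hpos 1)), fun n => ?_⟩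
    induction n using Nat.twoStepInduction with
    | zero => rw [pow_zero, one_mul]; exact min_le_left _ _
    | one => rw [pow_one]; exact min_le_right _ _
    | more n ih _ =>
      refine ih.trans ?_
      rw [pow_add, mul_assoc]
      gcongr
      have := hrat n
      rwa [one_div, inv_mul_le_iff₀ (by positivity)] at this
  obtain ⟨c, hc, hcle⟩ := hge
  have hB : ∀ n, a n * ∑' t, radialWalkCount q t n * z ^ t ≤ ∑' t, b t * z ^ t := by
    intro n
    rw [← tsum_mul_left]
    refine ((hs n).mul_left _).tsum_le_tsum (fun t => ?_) hb
    rw [← mul_assoc]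
    gcongr
    exact mul_radialWalkCount_le hq ha hab t n
  have hB0 : 0 ≤ ∑' t, b t * z ^ t :=
    tsum_nonneg fun t => mul_nonneg (walkSeries_nonneg hq ha hab t) (by positivity)
  refine ⟨(∑' t, b t * z ^ t) / c + 1, by positivity, fun n => ?_⟩
  calc a n = a n * c / c := by field_simp
    _ ≤ a n * (y ^ n * ∑' t, radialWalkCount q t n * z ^ t) / c := by
        gcongr
        · exact ha n
        · exact hcle n
    _ = (a n * ∑' t, radialWalkCount q t n * z ^ t) / c * y ^ n := by ring
    _ ≤ (∑' t, b t * z ^ t) / c * y ^ n := by gcongr; exact hB n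
    _ ≤ ((∑' t, b t * z ^ t) / c + 1) * y ^ n := by gcongr; linarith

end LowerBound

include hq hper ha hab in
theorem limsup_walk_formula (hne : ∃ n, 1 ≤ a n) {C K : ℝ} (hC : 0 < C) (hK : 0 < K)
    (haK : ∀ n, a n ≤ C * K ^ n) {α β : ℝ}
    (hα : α = limsup (fun n : ℕ => a n ^ ((1 : ℝ) / n)) atTop)
    (hβ : β = limsup (fun n : ℕ => b n ^ ((1 : ℝ) / n)) atTop) :
    (α ≤ (q 0 * q 1) ^ ((1 : ℝ) / 4) → β = √(q 0) + √(q 1)) ∧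
      ((q 0 * q 1) ^ ((1 : ℝ) / 4) ≤ α → β = walkGrowth (q 0 + q 1) (q 0 * q 1) α) := by
  have h0 := hq 0
  have h1 := hq 1
  have hbn := walkSeries_nonneg hq ha hab
  have hα_bdd := isBoundedUnder_rpow_of_le_mul_pow ha hC hK haK
  have hα0 : 0 ≤ α := hα ▸ limsup_rpow_nonneg ha hα_bdd
  have hσ : 0 < q 0 + q 1 := by linarith
  have hπ : 1 ≤ q 0 * q 1 := one_le_mul_of_one_le_of_one_le h0 h1
  set y₀ := (q 0 * q 1) ^ ((1 : ℝ) / 4) with hy₀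
  have hy₀1 : 1 ≤ y₀ := Real.one_le_rpow hπ (by norm_num)
  have hy₀4 : y₀ ^ 4 = q 0 * q 1 := by
    rw [hy₀, ← Real.rpow_natCast, ← Real.rpow_mul (by positivity)]
    norm_num
  have hgrowth : walkGrowth (q 0 + q 1) (q 0 * q 1) y₀ = √(q 0) + √(q 1) :=
    walkGrowth_rpow_one_div_four (by linarith) (by linarith)
  set L := walkGrowth (q 0 + q 1) (q 0 * q 1) with hL
  have hLpos : ∀ y, 0 < L y := fun y => walkGrowth_pos hσ (by positivity) y
  have hupper : ∀ y, 1 ≤ y → α < y → ∃ M > 0, ∀ t, b t ≤ M * L y ^ t := by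
    intro y hy hαy
    obtain ⟨w, hαw, hwy⟩ := exists_between hαy
    obtain ⟨M, hM, hMle⟩ := exists_le_mul_pow_of_limsup_rpow_lt ha hα_bdd (hα ▸ hαw)
    exact exists_le_mul_walkGrowth_pow hq hper hab hy (hα0.trans_lt hαw) hwy hM hMle
  have hβ_bdd : IsBoundedUnder (· ≤ ·) atTop fun n : ℕ => b n ^ ((1 : ℝ) / n) := by
    obtain ⟨M, hM, hMle⟩ := hupper (α + 1) (by linarith) (by linarith)
    exact isBoundedUnder_rpow_of_le_mul_pow hbn hM (hLpos _) hMle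
  have hβ0 : 0 ≤ β := hβ ▸ limsup_rpow_nonneg hbn hβ_bdd
  have hβ_le : ∀ x, 1 ≤ x → α ≤ x → β ≤ L x := by
    intro x hx hαx
    have hcont : Tendsto L (𝓝[>] x) (𝓝 (L x)) :=
      (continuousAt_walkGrowth _ _ (by linarith : x ≠ 0)).tendsto.mono_left nhdsWithin_le_nhds
    refine ge_of_tendsto hcont (eventually_nhdsWithin_of_forall fun y hy => ?_)
    obtain ⟨M, hM, hMle⟩ := hupper y (hx.trans (le_of_lt hy)) (hαx.trans_lt hy)
    exact hβ ▸ limsup_rpow_le_of_le_mul_pow hbn hM (hLpos y) hMle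
  have hsum : ∀ m, β < m → Summable fun t => b t * m⁻¹ ^ t := by
    intro m hm
    obtain ⟨w, hβw, hwm⟩ := exists_between hm
    obtain ⟨M, hM, hMle⟩ := exists_le_mul_pow_of_limsup_rpow_lt hbn hβ_bdd (hβ ▸ hβw)
    have hw : 0 < w := hβ0.trans_lt hβw
    have hm0 : 0 < m := hw.trans hwm
    refine Summable.of_nonneg_of_le (fun t => mul_nonneg (hbn t) (by positivity)) (fun t => ?_)
      ((summable_geometric_of_lt_one (r := w / m) (by positivity)
        ((div_lt_one hm0).2 hwm)).mul_left M)
    rw [div_eq_mul_inv, mul_pow, ← mul_assoc]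
    gcongr
    exact hMle t
  have hβ_ge : L y₀ ≤ β := by
    refine le_of_forall_gt_imp_ge_of_dense fun m hm => ?_
    rw [hgrowth]
    simpa using sqrt_add_sqrt_le_inv hq hper ha hab hne (inv_pos.2 (hβ0.trans_lt hm)) (hsum m hm)
  refine ⟨fun h => hgrowth ▸ le_antisymm (hβ_le y₀ hy₀1 h) hβ_ge, fun h => ?_⟩
  refine le_antisymm (hβ_le α (hy₀1.trans h) le_rfl) ?_
  rcases h.eq_or_lt with h | h
  · rwa [← h]
  by_contra! hlt
  have hev : ∀ᶠ y in 𝓝[<] α, β < L y :=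
    ((continuousAt_walkGrowth _ _ (by linarith : α ≠ 0)).tendsto.mono_left
      nhdsWithin_le_nhds).eventually_const_lt hlt
  obtain ⟨y, hy, hy₀y, hyα⟩ := (hev.and (Ioo_mem_nhdsLT h)).exists
  have hypos : 0 < y := by linarith [hy₀y]
  obtain ⟨M, hM, hMle⟩ := exists_le_mul_pow_of_summable hq hper ha hab hne
    (inv_pos.2 (hLpos y)) (hsum _ hy) hypos
    (by rw [← hy₀4]; exact pow_le_pow_left₀ (by linarith) hy₀y.le 4) (by rw [inv_inv])
  exact hyα.not_ge (hα ▸ limsup_rpow_le_of_le_mul_pow ha hM hypos hMle)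

end Growth

namespace SimpleGraph

variable {V : Type*} {G : SimpleGraph V}

lemma IsTree.eq_of_dist_eq_add_one (hG : G.IsTree) {o v w w' : V} (hw : G.Adj v w)
    (hw' : G.Adj v w') (h : G.dist o v = G.dist o w + 1) (h' : G.dist o v = G.dist o w' + 1) :
    w = w' := by
  obtain ⟨p, hp, -⟩ := hG.connected.exists_path_of_dist o v
  have key : ∀ x, G.Adj v x → G.dist o v = G.dist o x + 1 → x = p.penultimate := by
    intro x hx hd
    obtain ⟨r, hr, hrl⟩ := hG.connected.exists_path_of_dist o x
    have hr' : (r.concat hx.symm).IsPath :=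
      Walk.isPath_of_length_eq_dist _ (by rw [Walk.length_concat, hrl, hd])
    rw [(hG.existsUnique_path o v).unique hp hr', Walk.penultimate_concat]
  rw [key w hw h, key w' hw' h']

lemma Connected.exists_adj_dist_eq (hG : G.Connected) {o v : V} {n : ℕ}
    (hv : G.dist o v = n + 1) : ∃ w, G.Adj v w ∧ G.dist o w = n := by
  obtain ⟨p, hpl⟩ := hG.exists_walk_length_eq_dist o v
  have hnil : ¬ p.Nil := by
    rw [← Walk.length_eq_zero_iff]
    omega
  have hadj := p.adj_penultimate hnil
  have h1 := G.dist_le p.dropLast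
  have h2 := Walk.length_dropLast_add_one hnil
  have h3 := hG.dist_triangle (u := o) (v := p.penultimate) (w := v)
  rw [dist_eq_one_iff_adj.2 hadj] at h3
  exact ⟨_, hadj.symm, by omega⟩

variable [G.LocallyFinite]

lemma IsTree.sum_neighborFinset_dist (hG : G.IsTree) (o v : V) (f : ℕ → ℝ) {n : ℕ}
    (hv : G.dist o v = n + 1) :
    ∑ u ∈ G.neighborFinset v, f (G.dist o u) = f n + ((G.degree v : ℝ) - 1) * f (n + 2) := by
  classical
  obtain ⟨w, hadj, hdw⟩ := hG.connected.exists_adj_dist_eq hv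
  have hmem : w ∈ G.neighborFinset v := (G.mem_neighborFinset _ _).2 hadj
  rw [← Finset.add_sum_erase _ _ hmem, hdw]
  congr 1
  rw [Finset.sum_congr rfl (g := fun _ => f (n + 2)), Finset.sum_const, nsmul_eq_mul,
    Finset.card_erase_of_mem hmem, card_neighborFinset_eq_degree, Nat.cast_sub, Nat.cast_one]
  · rw [← card_neighborFinset_eq_degree]
    exact Finset.card_pos.2 ⟨_, hmem⟩
  · intro u hu
    rw [Finset.mem_erase, mem_neighborFinset] at hu
    rcases hG.dist_eq_dist_add_one_of_adj o hu.2 with h | h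
    · exact absurd (hG.eq_of_dist_eq_add_one hu.2 hadj h (by rw [hdw, hv])) hu.1
    · rw [h, hv]

lemma sum_neighborFinset_dist_self (o : V) (f : ℕ → ℝ) :
    ∑ u ∈ G.neighborFinset o, f (G.dist o u) = G.degree o * f 1 := by
  rw [Finset.sum_congr rfl (g := fun _ => f 1), Finset.sum_const, nsmul_eq_mul,
    card_neighborFinset_eq_degree]
  intro u hu
  rw [dist_eq_one_iff_adj.2 ((G.mem_neighborFinset _ _).1 hu)]

omit [G.LocallyFinite] in
/-- Walks of length `t + 1`, sorted by their first step. -/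
def walkLengthSuccEquiv (v o : V) (t : ℕ) :
    {p : G.Walk v o // p.length = t + 1} ≃
      Σ u : G.neighborSet v, {p : G.Walk u.1 o // p.length = t} where
  toFun
    | ⟨.cons h p, hp⟩ => ⟨⟨_, h⟩, ⟨p, by simpa using hp⟩⟩
  invFun r := ⟨.cons r.1.2 r.2.1, congrArg (· + 1) r.2.2⟩
  left_inv
    | ⟨.cons h p, hp⟩ => rfl
  right_inv _ := rfl

lemma card_walk_length_succ (v o : V) (t : ℕ) :
    Nat.card {p : G.Walk v o // p.length = t + 1} =
      ∑ u ∈ G.neighborFinset v, Nat.card {p : G.Walk u o // p.length = t} := by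
  classical
  rw [Nat.card_congr (walkLengthSuccEquiv v o t), Nat.card_sigma,
    Finset.sum_subtype (p := fun u => u ∈ G.neighborSet v) (G.neighborFinset v)
      fun u => by rw [mem_neighborFinset, mem_neighborSet]]

lemma IsTree.card_walk_length (hG : G.IsTree) {o : V} {q : ℕ → ℝ}
    (hq : ∀ v, (G.degree v : ℝ) = q (G.dist o v) + 1) (t : ℕ) (v : V) :
    (Nat.card {p : G.Walk v o // p.length = t} : ℝ) = radialWalkCount q t (G.dist o v) := by
  induction t generalizing v with
  | zero =>
    rw [radialWalkCount]
    split_ifs with h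
    · obtain rfl := hG.connected.dist_eq_zero_iff.1 h
      have : Unique {p : G.Walk o o // p.length = 0} :=
        { default := ⟨.nil, rfl⟩
          uniq := fun p => Subtype.ext (by
            obtain ⟨_ | _, hp⟩ := p
            · rfl
            · simp at hp) }
      rw [Nat.card_unique, Nat.cast_one]
    · have : IsEmpty {p : G.Walk v o // p.length = 0} :=
        ⟨fun p => h (by rw [Walk.eq_of_length_eq_zero p.2, dist_self])⟩
      rw [Nat.card_of_isEmpty, Nat.cast_zero]
  | succ t ih =>
    rw [card_walk_length_succ, Nat.cast_sum, Finset.sum_congr rfl fun u _ => ih u]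
    rcases hd : G.dist o v with _ | n
    · obtain rfl := hG.connected.dist_eq_zero_iff.1 hd
      rw [sum_neighborFinset_dist_self, hq, hd, radialWalkCount]
    · rw [hG.sum_neighborFinset_dist o v _ hd, hq, hd, radialWalkCount]
      ring

lemma Connected.exists_finset_sphere (hG : G.Connected) (o : V) {K : ℕ}
    (hK : ∀ v, G.degree v ≤ K) (n : ℕ) :
    ∃ F : Finset V, (∀ v, G.dist o v = n → v ∈ F) ∧ F.card ≤ K ^ n := by
  classical
  induction n with
  | zero => exact ⟨{o}, fun v hv => by simp [hG.dist_eq_zero_iff.1 hv], by simp⟩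
  | succ n ih =>
    obtain ⟨F, hF, hcard⟩ := ih
    refine ⟨F.biUnion fun v => G.neighborFinset v, fun v hv => ?_, ?_⟩
    · obtain ⟨w, hadj, hdw⟩ := hG.exists_adj_dist_eq hv
      exact Finset.mem_biUnion.2 ⟨w, hF w hdw, (G.mem_neighborFinset _ _).2 hadj.symm⟩
    · rw [pow_succ]
      exact (Finset.card_biUnion_le_card_mul _ _ K fun v _ => by
        rw [card_neighborFinset_eq_degree]; exact hK v).trans (by gcongr)

lemma Connected.finite_sphere (hG : G.Connected) (o : V) {K : ℕ} (hK : ∀ v, G.degree v ≤ K)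
    (n : ℕ) : {v | G.dist o v = n}.Finite := by
  obtain ⟨F, hF, -⟩ := hG.exists_finset_sphere o hK n
  exact F.finite_toSet.subset hF

lemma Connected.card_sphere_le (hG : G.Connected) (o : V) {K : ℕ} (hK : ∀ v, G.degree v ≤ K)
    (S : Set V) (n : ℕ) : Nat.card {v : V // v ∈ S ∧ G.dist o v = n} ≤ K ^ n := by
  obtain ⟨F, hF, hcard⟩ := hG.exists_finset_sphere o hK n
  refine le_trans ?_ hcard
  rw [← Nat.card_eq_finsetCard]
  exact Nat.card_le_card_of_injective (fun v => (⟨v.1, hF _ v.2.2⟩ : F))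
    fun v w h => Subtype.ext (congrArg (fun x : F => x.1) h)

/-- Walks of length `t` ending in `S`, sorted by their endpoint. -/
def walksEndingEquiv (o : V) (S : Set V) (t : ℕ) :
    {r : Σ v : V, G.Walk o v // r.2.length = t ∧ r.1 ∈ S} ≃
      Σ v : {v : V // v ∈ S ∧ G.dist o v ≤ t}, {p : G.Walk v.1 o // p.length = t} where
  toFun r := ⟨⟨r.1.1, r.2.2, (G.dist_le r.1.2).trans_eq r.2.1⟩, ⟨r.1.2.reverse, by simp [r.2.1]⟩⟩
  invFun r := ⟨⟨r.1.1, r.2.1.reverse⟩, by simp [r.2.2], r.1.2.1⟩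
  left_inv r := by simp
  right_inv r := by simp

lemma IsTree.card_walks_ending (hG : G.IsTree) {o : V} {q : ℕ → ℝ}
    (hq : ∀ v, (G.degree v : ℝ) = q (G.dist o v) + 1) {K : ℕ} (hK : ∀ v, G.degree v ≤ K)
    (S : Set V) (t : ℕ) :
    (Nat.card {r : Σ v : V, G.Walk o v // r.2.length = t ∧ r.1 ∈ S} : ℝ) =
      ∑ n ∈ Finset.range (t + 1),
        (Nat.card {v : V // v ∈ S ∧ G.dist o v = n} : ℝ) * radialWalkCount q t n := by
  classical
  have hfin : {v | v ∈ S ∧ G.dist o v ≤ t}.Finite := by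
    refine ((Set.finite_Iic t).biUnion fun n _ =>
      hG.connected.finite_sphere o hK n).subset fun v hv => ?_
    simpa using hv.2
  let F := hfin.toFinset
  have hF : ∀ v, v ∈ F ↔ v ∈ S ∧ G.dist o v ≤ t := fun v => by simp [F]
  let _ : Fintype {v : V // v ∈ S ∧ G.dist o v ≤ t} := Fintype.subtype F hF
  rw [Nat.card_congr (walksEndingEquiv o S t), Nat.card_sigma, Nat.cast_sum,
    Finset.sum_congr rfl fun v _ => hG.card_walk_length hq t v.1,
    ← Finset.sum_subtype F hF fun v => radialWalkCount q t (G.dist o v),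
    ← Finset.sum_fiberwise_of_maps_to (g := fun v => G.dist o v) (t := Finset.range (t + 1))
      fun v hv => Finset.mem_range.2 (Nat.lt_succ_of_le ((hF v).1 hv).2)]
  refine Finset.sum_congr rfl fun n hn => ?_
  rw [Finset.sum_congr rfl (g := fun _ => radialWalkCount q t n)
    fun v hv => by rw [(Finset.mem_filter.1 hv).2], Finset.sum_const, nsmul_eq_mul,
    Nat.subtype_card]
  intro v
  rw [Finset.mem_filter, hF]
  have := Finset.mem_range.1 hn
  constructor
  · rintro ⟨⟨h1, -⟩, h2⟩; exact ⟨h1, h2⟩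
  · rintro ⟨h1, h2⟩; exact ⟨⟨h1, by omega⟩, h2⟩

end SimpleGraph

/-- Biregular cogrowth formula: for a nonempty subset `S` of the `(c,d)`-biregular tree
(`2 ≤ c < d`) with `a_t(S)` the number of vertices of `S` at distance `t` from the root `o`,
`b_t(S)` the number of walks of length `t` from `o` ending in `S`,
`α = limsup a_t(S)^{1/t}` and `β = limsup b_t(S)^{1/t}`:
`β = √(c−1)+√(d−1)` if `α ≤ ((c−1)(d−1))^{1/4}`, and
`β = √(α² + c + d − 2 + (c−1)(d−1)/α²)` if `α ≥ ((c−1)(d−1))^{1/4}`. -/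
theorem biregular_cogrowth_formula (c d : ℕ) (hc : 2 ≤ c) (hcd : c < d) {V : Type*}
    (G : SimpleGraph V) [G.LocallyFinite] (hconn : G.Connected) (hacyc : G.IsAcyclic)
    (hdeg : ∀ v : V, G.degree v = c ∨ G.degree v = d)
    (hbip : ∀ v w : V, G.Adj v w →
      (G.degree v = c ∧ G.degree w = d) ∨ (G.degree v = d ∧ G.degree w = c))
    (o : V) (S : Set V) (hS : S.Nonempty) :
    ∀ α β : ℝ,
      α = Filter.limsup
          (fun t : ℕ =>
            ((Nat.card {v : V // v ∈ S ∧ G.dist o v = t} : ℝ)) ^ ((1 : ℝ) / t))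
          Filter.atTop →
      β = Filter.limsup
          (fun t : ℕ =>
            ((Nat.card {q : Σ v : V, G.Walk o v // q.2.length = t ∧ q.1 ∈ S} : ℝ)) ^
              ((1 : ℝ) / t))
          Filter.atTop →
      (α ≤ (((c : ℝ) - 1) * ((d : ℝ) - 1)) ^ ((1 : ℝ) / 4) →
        β = Real.sqrt ((c : ℝ) - 1) + Real.sqrt ((d : ℝ) - 1)) ∧
      ((((c : ℝ) - 1) * ((d : ℝ) - 1)) ^ ((1 : ℝ) / 4) ≤ α →
        β = Real.sqrt (α ^ 2 + (c : ℝ) + (d : ℝ) - 2 +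
          ((c : ℝ) - 1) * ((d : ℝ) - 1) / α ^ 2)) := by
  intro α β hα hβ
  have hT : G.IsTree := ⟨hconn, hacyc⟩
  set q : ℕ → ℝ := fun n => (if Even n then (G.degree o : ℝ) else c + d - G.degree o) - 1 with hqdef
  have hc' : (2 : ℝ) ≤ c := by exact_mod_cast hc
  have hd' : (2 : ℝ) ≤ d := by exact_mod_cast (hc.trans hcd.le)
  have hq0 : q 0 = G.degree o - 1 := by simp [hqdef]
  have hq1 : q 1 = c + d - G.degree o - 1 := by simp [hqdef]
  have hq : ∀ n, 1 ≤ q n := by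
    intro n
    simp only [hqdef]
    rcases hdeg o with h | h <;> rw [h] <;> split_ifs <;> linarith
  have hper : ∀ n, q (n + 2) = q n := by
    intro n
    simp [hqdef, Nat.even_add]
  have hadj : ∀ v w, G.Adj v w → (G.degree w : ℝ) = c + d - G.degree v := by
    intro v w h
    rcases hbip v w h with ⟨h1, h2⟩ | ⟨h1, h2⟩ <;> rw [h1, h2] <;> ring
  have hdq : ∀ v, (G.degree v : ℝ) = q (G.dist o v) + 1 := by
    intro v
    induction hn : G.dist o v generalizing v with
    | zero =>
      rw [← hconn.dist_eq_zero_iff.1 hn, hq0]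
      ring
    | succ n ih =>
      obtain ⟨w, hvw, hw⟩ := hconn.exists_adj_dist_eq hn
      have hqn := sum_period_two hper n
      rw [hadj w v hvw.symm, ih w hw]
      linarith
  have hK : ∀ v, G.degree v ≤ d := by
    intro v
    rcases hdeg v with h | h <;> omega
  have hne : ∃ n, (1 : ℝ) ≤ (Nat.card {v : V // v ∈ S ∧ G.dist o v = n} : ℝ) := by
    obtain ⟨s, hs⟩ := hS
    refine ⟨G.dist o s, ?_⟩
    have : Finite {v : V // v ∈ S ∧ G.dist o v = G.dist o s} :=
      (hconn.finite_sphere o hK (G.dist o s)).subset fun v hv => hv.2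
    have : Nonempty {v : V // v ∈ S ∧ G.dist o v = G.dist o s} := ⟨⟨s, hs, rfl⟩⟩
    exact_mod_cast Nat.card_pos
  have h := limsup_walk_formula hq hper (fun n => Nat.cast_nonneg _)
    (fun t => hT.card_walks_ending hdq hK S t) hne one_pos (by linarith : (0 : ℝ) < d)
    (fun n => by rw [one_mul]; exact_mod_cast hconn.card_sphere_le o hK S n) hα hβ
  have hsum : q 0 + q 1 = c + d - 2 := by rw [hq0, hq1]; ring
  have hprod : q 0 * q 1 = (c - 1) * (d - 1) := by
    rw [hq0, hq1]
    rcases hdeg o with h | h <;> rw [h] <;> ring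
  have hsqrt : √(q 0) + √(q 1) = √((c : ℝ) - 1) + √((d : ℝ) - 1) := by
    rw [hq0, hq1]
    rcases hdeg o with h | h <;> rw [h]
    · rw [add_sub_cancel_left]
    · rw [add_sub_cancel_right, add_comm]
  rw [hsqrt, hsum, hprod, walkGrowth] at h
  rwa [show α ^ 2 + (c : ℝ) + d - 2 = α ^ 2 + (c + d - 2) by ring]
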